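/- There is an absolute constant C with the following property. Let κ ≥ 1, let N > 0, and let q be a Schwartz function whose Fourier transform q̂ is supported in the annulus { ξ : N/2 ≤ |ξ| ≤ 2N }. Define the operator Λ(κ; q) acting on Schwartz functions u by Λ(κ;q) u := M₋( q · M₊ u ), where M₊ and M₋ are the Fourier multiplier operators with symbols ξ ↦ (κ + iξ)^{−1/2} and ξ ↦ (κ − iξ)^{−1/2} respectively (principal branch square roots). Then for every Schwartz u: ‖Λ(κ; q) u‖_{L²(ℝ)} ≤ C · ( √N / (κ + N) ) · √( log(4 + N²/κ²) ) · ‖q‖_{L²(ℝ)} · ‖u‖_{L²(ℝ)}. -/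

import Mathlib

open MeasureTheory

/-- The Fourier transform, normalized by `f̂(ξ) = (2π)^{-1/2} ∫ e^{-iξx} f(x) dx`. -/
noncomputable def fhat (f : ℝ → ℂ) (ξ : ℝ) : ℂ :=
  ((Real.sqrt (2 * Real.pi) : ℂ))⁻¹
    * ∫ x : ℝ, Complex.exp (-(Complex.I * (ξ : ℂ) * (x : ℂ))) * f x

/-- The inverse Fourier transform, `(2π)^{-1/2} ∫ e^{iξx} g(ξ) dξ`. -/
noncomputable def finv (g : ℝ → ℂ) (x : ℝ) : ℂ :=
  ((Real.sqrt (2 * Real.pi) : ℂ))⁻¹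
    * ∫ ξ : ℝ, Complex.exp (Complex.I * (ξ : ℂ) * (x : ℂ)) * g ξ

/-- The Fourier multiplier with symbol `(κ + iξ)^{-1/2}` (principal branch). -/
noncomputable def Mplus (κ : ℝ) (u : ℝ → ℂ) : ℝ → ℂ :=
  finv fun ξ => ((κ : ℂ) + Complex.I * (ξ : ℂ)) ^ (-(1 / 2 : ℂ)) * fhat u ξ

/-- The Fourier multiplier with symbol `(κ - iξ)^{-1/2}` (principal branch). -/
noncomputable def Mminus (κ : ℝ) (u : ℝ → ℂ) : ℝ → ℂ :=
  finv fun ξ => ((κ : ℂ) - Complex.I * (ξ : ℂ)) ^ (-(1 / 2 : ℂ)) * fhat u ξ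

/-- The operator `Λ(κ;q) u = (κ - ∂)^{-1/2} ( q · (κ + ∂)^{-1/2} u )`. -/
noncomputable def Lam (κ : ℝ) (q u : ℝ → ℂ) : ℝ → ℂ :=
  Mminus κ fun x => q x * Mplus κ u x

open SchwartzMap FourierTransform Real

/-- Dilation of the real line as a continuous linear equivalence. -/
noncomputable def dilation (a : ℝ) (ha : a ≠ 0) : ℝ ≃L[ℝ] ℝ :=
  ContinuousLinearEquiv.unitsEquivAut ℝ (Units.mk0 a ha)

lemma inv_two_pi_ne_zero : (2 * π)⁻¹ ≠ 0 := by positivity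

/-- `fhat` as an operation on Schwartz functions. -/
noncomputable def fhatSchwartz (f : 𝓢(ℝ, ℂ)) : 𝓢(ℝ, ℂ) :=
  ((√(2 * π) : ℂ))⁻¹ •
    SchwartzMap.compCLMOfContinuousLinearEquiv ℂ (dilation _ inv_two_pi_ne_zero) (𝓕 f)

/-- `finv` as an operation on Schwartz functions. -/
noncomputable def finvSchwartz (f : 𝓢(ℝ, ℂ)) : 𝓢(ℝ, ℂ) :=
  ((√(2 * π) : ℂ))⁻¹ •
    SchwartzMap.compCLMOfContinuousLinearEquiv ℂ (dilation _ inv_two_pi_ne_zero) (𝓕⁻ f)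

lemma fhat_eq_fourier (f : ℝ → ℂ) (ξ : ℝ) :
    fhat f ξ = ((√(2 * π) : ℂ))⁻¹ * 𝓕 f (ξ * (2 * π)⁻¹) := by
  rw [fhat, Real.fourier_eq']
  congr 1
  refine integral_congr_ae (.of_forall fun x => ?_)
  simp only [smul_eq_mul]
  congr 2
  have : (π : ℂ) ≠ 0 := by exact_mod_cast pi_ne_zero
  simp
  field_simp

lemma finv_eq_fourierInv (f : ℝ → ℂ) (x : ℝ) :
    finv f x = ((√(2 * π) : ℂ))⁻¹ * 𝓕⁻ f (x * (2 * π)⁻¹) := by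
  rw [finv, Real.fourierInv_eq']
  congr 1
  refine integral_congr_ae (.of_forall fun x => ?_)
  simp only [smul_eq_mul]
  congr 2
  have : (π : ℂ) ≠ 0 := by exact_mod_cast pi_ne_zero
  simp
  field_simp

lemma coe_fhatSchwartz (f : 𝓢(ℝ, ℂ)) : ⇑(fhatSchwartz f) = fhat f := by
  ext ξ
  rw [fhat_eq_fourier, ← SchwartzMap.fourier_coe]
  rfl

lemma coe_finvSchwartz (f : 𝓢(ℝ, ℂ)) : ⇑(finvSchwartz f) = finv f := by
  ext ξ
  rw [finv_eq_fourierInv, ← SchwartzMap.fourierInv_coe]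
  rfl

lemma norm_inv_sqrt_two_pi_sq : ‖((√(2 * π) : ℂ))⁻¹‖ ^ 2 = (2 * π)⁻¹ := by
  rw [norm_inv, Complex.norm_real, inv_pow, Real.norm_eq_abs, sq_abs, sq_sqrt (by positivity)]

lemma integral_norm_sq_rescale (g : ℝ → ℂ) :
    ∫ x, ‖((√(2 * π) : ℂ))⁻¹ * g (x * (2 * π)⁻¹)‖ ^ 2 = ∫ x, ‖g x‖ ^ 2 := by
  simp_rw [norm_mul, mul_pow, norm_inv_sqrt_two_pi_sq]
  rw [integral_const_mul, Measure.integral_comp_mul_right (fun x => ‖g x‖ ^ 2), inv_inv,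
    abs_of_pos (by positivity), smul_eq_mul, inv_mul_cancel_left₀ (by positivity)]

lemma integrable_norm_sq_fhat (f : 𝓢(ℝ, ℂ)) : Integrable fun ξ => ‖fhat f ξ‖ ^ 2 := by
  rw [← coe_fhatSchwartz]
  exact ((fhatSchwartz f).memLp 2).integrable_norm_pow two_ne_zero

/-- Plancherel for `fhat`. -/
lemma integral_norm_sq_fhat (f : 𝓢(ℝ, ℂ)) : ∫ ξ, ‖fhat f ξ‖ ^ 2 = ∫ x, ‖f x‖ ^ 2 := by
  simp_rw [fhat_eq_fourier]
  rw [integral_norm_sq_rescale, ← SchwartzMap.integral_norm_sq_fourier f, SchwartzMap.fourier_coe]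

/-- Plancherel for `finv`. -/
lemma integral_norm_sq_finv (f : 𝓢(ℝ, ℂ)) : ∫ ξ, ‖finv f ξ‖ ^ 2 = ∫ x, ‖f x‖ ^ 2 := by
  simp_rw [finv_eq_fourierInv]
  rw [integral_norm_sq_rescale, ← SchwartzMap.fourierInv_coe,
    ← SchwartzMap.integral_norm_sq_fourier, FourierTransform.fourier_fourierInv_eq]

/-- Fourier inversion. -/
lemma finv_fhat (f : 𝓢(ℝ, ℂ)) : finv (fhat f) = f := by
  ext x
  have h : fhat (⇑f) = fun ξ => ((√(2 * π) : ℂ))⁻¹ * 𝓕 (⇑f) (ξ * (2 * π)⁻¹) :=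
    funext (fhat_eq_fourier f)
  have key : 𝓕⁻ (𝓕 (⇑f)) x = f x := by
    rw [← SchwartzMap.fourier_coe, ← SchwartzMap.fourierInv_coe,
      FourierTransform.fourierInv_fourier_eq]
  rw [← key, Real.fourierInv_eq', finv, h]
  have hs := Measure.integral_comp_mul_right
    (fun v : ℝ => Complex.exp (↑(2 * π * inner ℝ v x) * Complex.I) • 𝓕 (⇑f) v) (2 * π)⁻¹
  rw [inv_inv, abs_of_pos (by positivity)] at hs
  have hc : ((√(2 * π) : ℂ))⁻¹ * ((√(2 * π) : ℂ))⁻¹ = ((2 * π : ℝ) : ℂ)⁻¹ := by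
    rw [← mul_inv, ← Complex.ofReal_mul, mul_self_sqrt (by positivity)]
  rw [← inv_smul_eq_iff₀ (by positivity)] at hs
  rw [← hs, Complex.real_smul, Complex.ofReal_inv, ← hc, mul_assoc]
  congr 1
  rw [← integral_const_mul]
  refine integral_congr_ae (.of_forall fun ξ => ?_)
  simp only [smul_eq_mul]
  rw [mul_left_comm]
  congr 3
  have : (π : ℂ) ≠ 0 := by exact_mod_cast pi_ne_zero
  simp
  field_simp

/-- The symbol `(κ + c ξ)^a` with `c` imaginary has temperate growth. -/
lemma hasTemperateGrowth_cpow {κ : ℝ} (hκ : 1 ≤ κ) {c : ℂ} (hc : c.re = 0) {r : ℝ} (hr : r ≤ 0) :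
    (fun ξ : ℝ => ((κ : ℂ) + c * (ξ : ℂ)) ^ (r : ℂ)).HasTemperateGrowth := by
  have hre (ξ : ℝ) : ((κ : ℂ) + c * (ξ : ℂ)).re = κ := by simp [hc]
  have hslit (ξ : ℝ) : (κ : ℂ) + c * (ξ : ℂ) ∈ Complex.slitPlane := by
    left; rw [hre]; linarith
  have hderiv (a : ℂ) (ξ : ℝ) : HasDerivAt (fun ξ : ℝ => ((κ : ℂ) + c * (ξ : ℂ)) ^ a)
      (a * c * ((κ : ℂ) + c * (ξ : ℂ)) ^ (a - 1)) ξ := by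
    have h1 : HasDerivAt (fun ξ : ℝ => (κ : ℂ) + c * (ξ : ℂ)) c ξ := by
      simpa using ((Complex.ofRealCLM.hasDerivAt (x := ξ)).const_mul c).const_add (κ : ℂ)
    convert! HasDerivAt.comp_of_eq ξ
      (HasDerivAt.cpow_const (c := a) (hasDerivAt_id ((κ : ℂ) + c * (ξ : ℂ))) (hslit ξ)) h1 rfl
      using 1
    simp; ring
  have hiter (n : ℕ) : ∃ A : ℂ, iteratedDeriv n (fun ξ : ℝ => ((κ : ℂ) + c * (ξ : ℂ)) ^ (r : ℂ))
      = fun ξ : ℝ => A * ((κ : ℂ) + c * (ξ : ℂ)) ^ ((r : ℂ) - n) := by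
    induction n with
    | zero => exact ⟨1, by simp⟩
    | succ n ih =>
      obtain ⟨A, hA⟩ := ih
      refine ⟨A * ((r - n) * c), ?_⟩
      rw [iteratedDeriv_succ, hA]
      ext ξ
      rw [((hderiv _ ξ).const_mul A).deriv]
      push_cast
      rw [sub_sub]
      ring
  refine ⟨?_, fun n => ?_⟩
  · refine contDiff_of_differentiable_iteratedDeriv fun n _ => ?_
    obtain ⟨A, hA⟩ := hiter n
    rw [hA]
    exact fun ξ => ((hderiv _ ξ).const_mul A).differentiableAt
  · obtain ⟨A, hA⟩ := hiter n
    refine ⟨0, ‖A‖, fun ξ => ?_⟩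
    rw [norm_iteratedFDeriv_eq_norm_iteratedDeriv, hA, pow_zero, norm_mul]
    refine mul_le_mul_of_nonneg_left ?_ (norm_nonneg _)
    have : (r : ℂ) - n = ((r - n : ℝ) : ℂ) := by push_cast; rfl
    rw [this, Complex.norm_cpow_real]
    refine rpow_le_one_of_one_le_of_nonpos ?_ (by linarith [n.cast_nonneg (α := ℝ)])
    calc 1 ≤ κ := hκ
      _ = _ := (hre ξ).symm
      _ ≤ _ := Complex.re_le_norm _

/-- The integral kernel of multiplication by `q` on the Fourier side. -/
lemma fhat_mul_finv (q h : 𝓢(ℝ, ℂ)) (ξ : ℝ) :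
    fhat (fun x => q x * finv h x) ξ = ((√(2 * π) : ℂ))⁻¹ * ∫ η, fhat q (ξ - η) * h η := by
  have hint : Integrable (Function.uncurry fun x η : ℝ =>
      Complex.exp (-(Complex.I * (ξ : ℂ) * (x : ℂ))) * Complex.exp (Complex.I * (η : ℂ) * (x : ℂ))
        * (q x * h η)) (volume.prod volume) := by
    refine (q.integrable.mul_prod h.integrable).bdd_mul (c := 1) ?_ ?_
    · exact Continuous.aestronglyMeasurable (by fun_prop)
    · refine .of_forall fun p => ?_
      simp [Complex.norm_exp]
  have hswap := integral_integral_swap hint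
  simp only [fhat, finv]
  congr 1
  have hl : ∀ x : ℝ, Complex.exp (-(Complex.I * (ξ : ℂ) * (x : ℂ))) * (q x *
      (((√(2 * π) : ℂ))⁻¹ * ∫ η : ℝ, Complex.exp (Complex.I * (η : ℂ) * (x : ℂ)) * h η))
      = ((√(2 * π) : ℂ))⁻¹ * ∫ η : ℝ, Complex.exp (-(Complex.I * (ξ : ℂ) * (x : ℂ)))
        * Complex.exp (Complex.I * (η : ℂ) * (x : ℂ)) * (q x * h η) := by
    intro x
    rw [mul_left_comm (q x), mul_left_comm, ← integral_const_mul, ← integral_const_mul]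
    congr 2
    ext η
    ring
  simp_rw [hl]
  rw [integral_const_mul, hswap, ← integral_const_mul]
  congr 1
  ext η
  rw [mul_assoc, ← integral_mul_const]
  congr 2
  ext x
  rw [← Complex.exp_add]
  have : -(Complex.I * (ξ : ℂ) * x) + Complex.I * η * x
      = -(Complex.I * ((ξ - η : ℝ) : ℂ) * x) := by push_cast; ring
  rw [this]
  ring

/-- The symbol `(κ + c ξ)^{-1/2}`; it is used with `c = ±i`. -/
noncomputable def symb (κ : ℝ) (c : ℂ) (ξ : ℝ) : ℂ :=
  ((κ : ℂ) + c * (ξ : ℂ)) ^ (-(1 / 2 : ℂ))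

lemma hasTemperateGrowth_symb {κ : ℝ} (hκ : 1 ≤ κ) {c : ℂ} (hc : c.re = 0) :
    (symb κ c).HasTemperateGrowth := by
  convert hasTemperateGrowth_cpow hκ hc (r := -(1 / 2)) (by norm_num) using 2 with ξ
  simp [symb]

lemma norm_symb_sq (κ : ℝ) (c : ℂ) (ξ : ℝ) :
    ‖symb κ c ξ‖ ^ 2 = ‖(κ : ℂ) + c * (ξ : ℂ)‖⁻¹ := by
  have : (-(1 / 2 : ℂ)) = ((-(1 / 2) : ℝ) : ℂ) := by push_cast; rfl
  rw [symb, this, Complex.norm_cpow_real, ← rpow_natCast, ← rpow_mul (norm_nonneg _),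
    ← rpow_neg_one]
  norm_num

lemma norm_symb_sq_le_inv {κ : ℝ} (hκ : 1 ≤ κ) {c : ℂ} (hc : c.re = 0) (ξ : ℝ) :
    ‖symb κ c ξ‖ ^ 2 ≤ κ⁻¹ := by
  rw [norm_symb_sq]
  refine inv_anti₀ (by linarith) ?_
  simpa [hc] using Complex.re_le_norm ((κ : ℂ) + c * (ξ : ℂ))

lemma norm_symb_sq_le {κ : ℝ} (hκ : 1 ≤ κ) {c : ℂ} (hc : c.re = 0) (hc' : |c.im| = 1) (ξ : ℝ) :
    ‖symb κ c ξ‖ ^ 2 ≤ 2 / (κ + |ξ|) := by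
  have h1 := Complex.abs_re_le_norm ((κ : ℂ) + c * (ξ : ℂ))
  have h2 := Complex.abs_im_le_norm ((κ : ℂ) + c * (ξ : ℂ))
  simp only [Complex.add_re, Complex.ofReal_re, Complex.mul_re, hc, Complex.ofReal_im, mul_zero,
    zero_mul, sub_zero, add_zero, Complex.add_im, Complex.mul_im, zero_add, abs_mul, hc',
    one_mul] at h1 h2
  have h3 := le_abs_self κ
  have h4 := abs_nonneg ξ
  rw [norm_symb_sq, inv_eq_one_div, div_le_div_iff₀ (by linarith) (by linarith)]
  linarith

/-- The Fourier transform of `f` multiplied by the symbol, as a Schwartz function. -/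
noncomputable def symbMulFhat (κ : ℝ) (c : ℂ) (f : 𝓢(ℝ, ℂ)) : 𝓢(ℝ, ℂ) :=
  SchwartzMap.smulLeftCLM ℂ (symb κ c) (fhatSchwartz f)

lemma symbMulFhat_apply {κ : ℝ} (hκ : 1 ≤ κ) {c : ℂ} (hc : c.re = 0) (f : 𝓢(ℝ, ℂ)) (ξ : ℝ) :
    symbMulFhat κ c f ξ = symb κ c ξ * fhat f ξ := by
  rw [symbMulFhat, SchwartzMap.smulLeftCLM_apply_apply (hasTemperateGrowth_symb hκ hc),
    coe_fhatSchwartz, smul_eq_mul]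

lemma integral_norm_sq_symbMulFhat_le {κ : ℝ} (hκ : 1 ≤ κ) {c : ℂ} (hc : c.re = 0)
    (f : 𝓢(ℝ, ℂ)) : ∫ ξ, ‖symbMulFhat κ c f ξ‖ ^ 2 ≤ κ⁻¹ * ∫ x, ‖f x‖ ^ 2 := by
  rw [← integral_norm_sq_fhat f, ← integral_const_mul]
  refine integral_mono_of_nonneg (.of_forall fun ξ => by positivity) ?_ (.of_forall fun ξ => ?_)
  · exact (integrable_norm_sq_fhat f).const_mul _
  · simp only [symbMulFhat_apply hκ hc, norm_mul, mul_pow]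
    exact mul_le_mul_of_nonneg_right (norm_symb_sq_le_inv hκ hc ξ) (by positivity)

lemma Mplus_eq {κ : ℝ} (hκ : 1 ≤ κ) (u : 𝓢(ℝ, ℂ)) :
    Mplus κ u = finv (symbMulFhat κ Complex.I u) := by
  rw [Mplus]
  congr 1
  ext ξ
  rw [symbMulFhat_apply hκ Complex.I_re, symb]

lemma Mminus_eq {κ : ℝ} (hκ : 1 ≤ κ) (u : 𝓢(ℝ, ℂ)) :
    Mminus κ u = finv (symbMulFhat κ (-Complex.I) u) := by
  rw [Mminus]
  congr 1
  ext ξ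
  rw [symbMulFhat_apply hκ (by simp), symb, neg_mul, sub_eq_add_neg]

/-- The product of a Schwartz function with `finv` of another one, as a Schwartz function. -/
noncomputable def mulFinv (q h : 𝓢(ℝ, ℂ)) : 𝓢(ℝ, ℂ) :=
  SchwartzMap.smulLeftCLM ℂ q (finvSchwartz h)

lemma coe_mulFinv (q h : 𝓢(ℝ, ℂ)) : ⇑(mulFinv q h) = fun x => q x * finv h x := by
  ext x
  rw [mulFinv, SchwartzMap.smulLeftCLM_apply_apply q.hasTemperateGrowth, coe_finvSchwartz,
    smul_eq_mul]

lemma integral_norm_sq_Lam {κ : ℝ} (hκ : 1 ≤ κ) (q u : 𝓢(ℝ, ℂ)) :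
    ∫ x, ‖Lam κ q u x‖ ^ 2
      = ∫ ξ, ‖symbMulFhat κ (-Complex.I) (mulFinv q (symbMulFhat κ Complex.I u)) ξ‖ ^ 2 := by
  rw [← integral_norm_sq_finv, ← Mminus_eq hκ, coe_mulFinv, Lam, Mplus_eq hκ]

/-- The Cauchy–Schwarz inequality. -/
lemma sq_integral_norm_mul_le {α : Type*} [MeasurableSpace α] {μ : Measure α} {f g : α → ℂ}
    (hf : MemLp f 2 μ) (hg : MemLp g 2 μ) :
    (∫ x, ‖f x‖ * ‖g x‖ ∂μ) ^ 2 ≤ (∫ x, ‖f x‖ ^ 2 ∂μ) * ∫ x, ‖g x‖ ^ 2 ∂μ := by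
  have h := integral_mul_norm_le_Lp_mul_Lq (μ := μ) (f := f) (g := g) Real.HolderConjugate.two_two
    (by simpa using hf) (by simpa using hg)
  simp only [rpow_two, ← sqrt_eq_rpow] at h
  calc _ ≤ (√(∫ x, ‖f x‖ ^ 2 ∂μ) * √(∫ x, ‖g x‖ ^ 2 ∂μ)) ^ 2 := by
        gcongr
    _ = _ := by
      rw [mul_pow, sq_sqrt (by positivity), sq_sqrt (by positivity)]

/-- Bernstein's inequality. -/
lemma norm_sq_le_of_fhat_support {N : ℝ} (hN : 0 < N) (q : 𝓢(ℝ, ℂ))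
    (hq : ∀ ξ, fhat q ξ ≠ 0 → |ξ| ≤ 2 * N) (x : ℝ) :
    ‖q x‖ ^ 2 ≤ 4 * N * ∫ x, ‖q x‖ ^ 2 := by
  set Q := fhatSchwartz q
  have hQ : ⇑Q = fhat q := coe_fhatSchwartz q
  have h1 : ‖q x‖ ≤ ‖((√(2 * π) : ℂ))⁻¹‖ * ∫ ξ, ‖Q ξ‖ := by
    conv_lhs => rw [← finv_fhat q, finv, norm_mul]
    gcongr
    refine (norm_integral_le_integral_norm _).trans_eq ?_
    congr 1
    ext ξ
    simp [Complex.norm_exp, hQ]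
  have h2 : ∫ ξ, ‖Q ξ‖ = ∫ ξ in Set.Icc (-(2 * N)) (2 * N), ‖Q ξ‖ * ‖(1 : ℂ)‖ := by
    simp only [norm_one, mul_one]
    refine (setIntegral_eq_integral_of_forall_compl_eq_zero fun ξ hξ => ?_).symm
    by_contra h
    exact hξ (abs_le.1 (hq ξ fun h0 => h (by rw [hQ, h0, norm_zero])))
  have hm : MemLp Q 2 (volume.restrict (Set.Icc (-(2 * N)) (2 * N))) := (Q.memLp 2).restrict _
  have h3 : (∫ ξ, ‖Q ξ‖) ^ 2 ≤ (∫ x, ‖q x‖ ^ 2) * (4 * N) := by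
    rw [h2]
    refine (sq_integral_norm_mul_le hm (memLp_const 1)).trans ?_
    have : ∫ ξ in Set.Icc (-(2 * N)) (2 * N), ‖(1 : ℂ)‖ ^ 2 = 4 * N := by
      simp [Measure.real]
      rw [ENNReal.toReal_ofReal (by linarith)]
      ring
    rw [this]
    gcongr
    rw [← integral_norm_sq_fhat q, hQ]
    exact setIntegral_le_integral (integrable_norm_sq_fhat q)
      (.of_forall fun ξ => by positivity)
  have hpi : (2 * π)⁻¹ ≤ 1 := inv_le_one_of_one_le₀ (by linarith [pi_gt_three])
  have h4 : 0 ≤ ∫ x, ‖q x‖ ^ 2 := by positivity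
  calc ‖q x‖ ^ 2 ≤ (‖((√(2 * π) : ℂ))⁻¹‖ * ∫ ξ, ‖Q ξ‖) ^ 2 := by gcongr
    _ = (2 * π)⁻¹ * (∫ ξ, ‖Q ξ‖) ^ 2 := by rw [mul_pow, norm_inv_sqrt_two_pi_sq]
    _ ≤ 1 * ((∫ x, ‖q x‖ ^ 2) * (4 * N)) := by gcongr
    _ = _ := by ring

/-- The bound for low frequencies. -/
lemma integral_norm_sq_Lam_le_of_fhat_support {κ N : ℝ} (hκ : 1 ≤ κ) (hN : 0 < N) (q u : 𝓢(ℝ, ℂ))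
    (hq : ∀ ξ, fhat q ξ ≠ 0 → |ξ| ≤ 2 * N) :
    ∫ x, ‖Lam κ q u x‖ ^ 2
      ≤ 4 * N / κ ^ 2 * (∫ x, ‖q x‖ ^ 2) * ∫ x, ‖u x‖ ^ 2 := by
  have hκ0 : 0 < κ := by linarith
  rw [integral_norm_sq_Lam hκ]
  refine (integral_norm_sq_symbMulFhat_le hκ (by simp) _).trans ?_
  set h := symbMulFhat κ Complex.I u
  have h1 : ∫ x, ‖mulFinv q h x‖ ^ 2 ≤ (4 * N * ∫ x, ‖q x‖ ^ 2) * ∫ x, ‖h x‖ ^ 2 := by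
    rw [← integral_norm_sq_finv h, ← integral_const_mul]
    refine integral_mono_of_nonneg (.of_forall fun ξ => by positivity) ?_ (.of_forall fun x => ?_)
    · rw [← coe_finvSchwartz]
      exact (((finvSchwartz h).memLp 2).integrable_norm_pow two_ne_zero).const_mul _
    · simp only [coe_mulFinv, norm_mul, mul_pow]
      exact mul_le_mul_of_nonneg_right (norm_sq_le_of_fhat_support hN q hq x) (by positivity)
  have h2 := integral_norm_sq_symbMulFhat_le hκ Complex.I_re u
  have h3 : 0 ≤ ∫ x, ‖q x‖ ^ 2 := by positivity
  calc κ⁻¹ * ∫ x, ‖mulFinv q h x‖ ^ 2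
      ≤ κ⁻¹ * ((4 * N * ∫ x, ‖q x‖ ^ 2) * (κ⁻¹ * ∫ x, ‖u x‖ ^ 2)) := by
        gcongr
        exact h1.trans (by gcongr)
    _ = _ := by field_simp

/-- The integrable profile that dominates the kernel at frequency separation `Z`. -/
noncomputable def profile (κ Z x : ℝ) : ℝ := ((κ + |x|) * (κ + |x| + Z))⁻¹

lemma profile_nonneg {κ Z : ℝ} (hκ : 1 ≤ κ) (hZ : 0 < Z) (x : ℝ) : 0 ≤ profile κ Z x := by
  unfold profile
  positivity

lemma profile_le {κ Z : ℝ} (hκ : 1 ≤ κ) (hZ : 0 < Z) (x : ℝ) :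
    profile κ Z x ≤ (1 + x ^ 2)⁻¹ := by
  refine inv_anti₀ (by positivity) ?_
  nlinarith [abs_nonneg x, sq_abs x, mul_nonneg (abs_nonneg x) hZ.le]

lemma integrable_profile {κ Z : ℝ} (hκ : 1 ≤ κ) (hZ : 0 < Z) : Integrable (profile κ Z) := by
  refine integrable_inv_one_add_sq.mono' ?_ (.of_forall fun x => ?_)
  · unfold profile
    exact Measurable.aestronglyMeasurable (by fun_prop)
  · rw [Real.norm_of_nonneg (profile_nonneg hκ hZ x)]
    exact profile_le hκ hZ x

lemma integral_profile {κ Z : ℝ} (hκ : 1 ≤ κ) (hZ : 0 < Z) :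
    ∫ x, profile κ Z x = 2 / Z * log (1 + Z / κ) := by
  have hκ0 : 0 < κ := by linarith
  have hderiv : ∀ t ∈ Set.Ici (0 : ℝ),
      HasDerivAt (fun t => Z⁻¹ * (log (κ + t) - log (κ + t + Z)))
        ((κ + t) * (κ + t + Z))⁻¹ t := by
    intro t ht
    have ht : 0 ≤ t := ht
    have h1 : HasDerivAt (fun t => κ + t) 1 t := (hasDerivAt_id t).const_add κ
    have h2 := ((h1.log (by positivity)).sub
      ((h1.add_const Z).log (by positivity))).const_mul Z⁻¹
    convert! h2 using 1
    have : κ + t ≠ 0 := by positivity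
    have : κ + t + Z ≠ 0 := by positivity
    field_simp
    ring
  have hlim : Filter.Tendsto (fun t => Z⁻¹ * (log (κ + t) - log (κ + t + Z))) Filter.atTop
      (nhds 0) := by
    have h1 : Filter.Tendsto (fun t : ℝ => 1 + Z / (κ + t)) Filter.atTop (nhds (1 + 0)) :=
      (Filter.Tendsto.const_div_atTop (Filter.tendsto_atTop_add_const_left _ κ Filter.tendsto_id)
        Z).const_add 1
    rw [add_zero] at h1
    have h2 := ((h1.log one_ne_zero).const_mul (-Z⁻¹))
    rw [log_one, mul_zero] at h2
    refine h2.congr' ?_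
    filter_upwards [Filter.eventually_ge_atTop 0] with t ht
    have h3 : κ + t ≠ 0 := by positivity
    have : 1 + Z / (κ + t) = (κ + t + Z) / (κ + t) := by field_simp
    rw [this, log_div (by positivity) h3]
    ring
  have h := integral_Ioi_of_hasDerivAt_of_nonneg' hderiv
    (fun t ht => by have : 0 < t := ht; positivity) hlim
  unfold profile
  rw [integral_comp_abs (f := fun t => ((κ + t) * (κ + t + Z))⁻¹), h]
  have : 1 + Z / κ = (κ + Z) / κ := by field_simp
  rw [this, log_div (by positivity) (by positivity)]
  simp only [add_zero]
  ring

lemma norm_symb_sq_mul_le {κ Z : ℝ} (hκ : 1 ≤ κ) (hZ : 0 < Z) {c d : ℂ} (hc : c.re = 0)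
    (hc' : |c.im| = 1) (hd : d.re = 0) (hd' : |d.im| = 1) {ξ η : ℝ} (h : Z ≤ |ξ - η|) :
    ‖symb κ c ξ‖ ^ 2 * ‖symb κ d η‖ ^ 2 ≤ 8 * (profile κ Z ξ + profile κ Z η) := by
  refine (mul_le_mul (norm_symb_sq_le hκ hc hc' ξ) (norm_symb_sq_le hκ hd hd' η) (by positivity)
    (by positivity)).trans ?_
  unfold profile
  have hsep : Z ≤ (κ + |ξ|) + (κ + |η|) := by linarith [abs_sub ξ η]
  have ha : 0 < κ + |ξ| := by positivity
  have hb : 0 < κ + |η| := by positivity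
  set a := κ + |ξ|
  set b := κ + |η|
  have h1 : (a * (2 * (a + b)))⁻¹ ≤ (a * (a + Z))⁻¹ := by gcongr; linarith
  have h2 : (b * (2 * (a + b)))⁻¹ ≤ (b * (b + Z))⁻¹ := by gcongr; linarith
  have h3 : 2 / a * (2 / b) = 8 * ((a * (2 * (a + b)))⁻¹ + (b * (2 * (a + b)))⁻¹) := by
    field_simp
    ring
  rw [h3]
  gcongr

lemma norm_symb_le_one {κ : ℝ} (hκ : 1 ≤ κ) {c : ℂ} (hc : c.re = 0) (ξ : ℝ) :
    ‖symb κ c ξ‖ ≤ 1 := by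
  rw [← sq_le_one_iff₀ (norm_nonneg _)]
  exact (norm_symb_sq_le_inv hκ hc ξ).trans (inv_le_one_of_one_le₀ hκ)

open scoped Convolution

/-- Cauchy–Schwarz bound for the Fourier transform of `Lam κ q u`. -/
lemma norm_sq_symbMulFhat_mulFinv_le {κ Z : ℝ} (hκ : 1 ≤ κ) (hZ : 0 < Z) (q u : 𝓢(ℝ, ℂ))
    (hq : ∀ ξ, fhat q ξ ≠ 0 → Z ≤ |ξ|) (ξ : ℝ) :
    ‖symbMulFhat κ (-Complex.I) (mulFinv q (symbMulFhat κ Complex.I u)) ξ‖ ^ 2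
      ≤ 8 * (∫ x, ‖u x‖ ^ 2) * (profile κ Z ξ * (∫ x, ‖q x‖ ^ 2)
        + (profile κ Z ⋆[ContinuousLinearMap.mul ℝ ℝ] fun x => ‖fhat q x‖ ^ 2) ξ) := by
  have hI : (-Complex.I).re = 0 := by simp
  have hqL : MemLp (fun η => fhat q (ξ - η)) 2 := by
    rw [← coe_fhatSchwartz]
    exact ((fhatSchwartz q).memLp 2).comp_measurePreserving (Measure.measurePreserving_sub_left volume ξ)
  have hfL : MemLp (fun η => fhat q (ξ - η) * symb κ Complex.I η) 2 := by
    refine hqL.of_le (hqL.1.mul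
      (hasTemperateGrowth_symb hκ Complex.I_re).1.continuous.aestronglyMeasurable)
      (.of_forall fun η => ?_)
    rw [norm_mul]
    exact mul_le_of_le_one_right (norm_nonneg _) (norm_symb_le_one hκ Complex.I_re η)
  have huL : MemLp (fhat u) 2 := by
    rw [← coe_fhatSchwartz]
    exact (fhatSchwartz u).memLp 2
  have hpi : (2 * π)⁻¹ ≤ 1 := inv_le_one_of_one_le₀ (by linarith [pi_gt_three])
  have hfhat : ‖fhat (mulFinv q (symbMulFhat κ Complex.I u)) ξ‖ ^ 2
      ≤ (∫ η, ‖fhat q (ξ - η) * symb κ Complex.I η‖ ^ 2) * ∫ x, ‖u x‖ ^ 2 := by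
    rw [coe_mulFinv, fhat_mul_finv, norm_mul, mul_pow, norm_inv_sqrt_two_pi_sq]
    refine (mul_le_of_le_one_left (by positivity) hpi).trans ?_
    rw [← integral_norm_sq_fhat u]
    refine le_trans ?_ (sq_integral_norm_mul_le hfL huL)
    gcongr
    refine (norm_integral_le_integral_norm _).trans_eq ?_
    congr 1
    ext η
    rw [symbMulFhat_apply hκ Complex.I_re, ← norm_mul, mul_assoc]
  have hqI := integrable_norm_sq_fhat q
  have hconv : Integrable fun η => profile κ Z η * ‖fhat q (ξ - η)‖ ^ 2 := by
    refine (hqI.comp_sub_left ξ).bdd_mul (c := 1) (integrable_profile hκ hZ).1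
      (.of_forall fun η => ?_)
    rw [Real.norm_of_nonneg (profile_nonneg hκ hZ η)]
    refine (profile_le hκ hZ η).trans (inv_le_one_of_one_le₀ ?_)
    linarith [sq_nonneg η]
  have hkernel : ∫ η, ‖symb κ (-Complex.I) ξ‖ ^ 2 * ‖fhat q (ξ - η) * symb κ Complex.I η‖ ^ 2
      ≤ ∫ η, 8 * (profile κ Z ξ * ‖fhat q (ξ - η)‖ ^ 2
        + profile κ Z η * ‖fhat q (ξ - η)‖ ^ 2) := by
    refine integral_mono_of_nonneg (.of_forall fun η => by positivity)
      ((((hqI.comp_sub_left ξ).const_mul _).add hconv).const_mul 8) (.of_forall fun η => ?_)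
    by_cases h0 : fhat q (ξ - η) = 0
    · simp [h0]
    · have h1 := norm_symb_sq_mul_le hκ hZ hI (by simp) Complex.I_re (by simp) (hq _ h0)
      have h2 := mul_le_mul_of_nonneg_right h1 (sq_nonneg ‖fhat q (ξ - η)‖)
      simp only [norm_mul, mul_pow]
      linarith
  rw [symbMulFhat_apply hκ hI, norm_mul, mul_pow]
  rw [integral_const_mul, integral_const_mul,
    integral_add ((hqI.comp_sub_left ξ).const_mul _) hconv, integral_const_mul,
    integral_sub_left_eq_self (fun x => ‖fhat q x‖ ^ 2) volume ξ, integral_norm_sq_fhat] at hkernel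
  have hu : 0 ≤ ∫ x, ‖u x‖ ^ 2 := by positivity
  calc _ ≤ ‖symb κ (-Complex.I) ξ‖ ^ 2 *
        ((∫ η, ‖fhat q (ξ - η) * symb κ Complex.I η‖ ^ 2) * ∫ x, ‖u x‖ ^ 2) := by gcongr
    _ ≤ _ := by
      rw [← mul_assoc]
      refine (mul_le_mul_of_nonneg_right hkernel hu).trans_eq ?_
      simp only [MeasureTheory.convolution, ContinuousLinearMap.mul_apply']
      ring

/-- The Hilbert–Schmidt bound for high frequencies. -/
lemma integral_norm_sq_Lam_le_of_le_fhat_support {κ Z : ℝ} (hκ : 1 ≤ κ) (hZ : 0 < Z)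
    (q u : 𝓢(ℝ, ℂ)) (hq : ∀ ξ, fhat q ξ ≠ 0 → Z ≤ |ξ|) :
    ∫ x, ‖Lam κ q u x‖ ^ 2
      ≤ 32 / Z * log (1 + Z / κ) * (∫ x, ‖q x‖ ^ 2) * ∫ x, ‖u x‖ ^ 2 := by
  rw [integral_norm_sq_Lam hκ]
  have hP := integrable_profile hκ hZ
  have hqI := integrable_norm_sq_fhat q
  have hconv := hP.integrable_convolution (ContinuousLinearMap.mul ℝ ℝ) hqI
  refine (integral_mono_of_nonneg (.of_forall fun ξ => by positivity)
    (((hP.mul_const _).add hconv).const_mul _)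
    (.of_forall (norm_sq_symbMulFhat_mulFinv_le hκ hZ q u hq))).trans_eq ?_
  rw [integral_const_mul]
  simp only [Pi.add_apply]
  rw [integral_add (hP.mul_const _) hconv, integral_mul_const,
    integral_convolution _ hP hqI, ContinuousLinearMap.mul_apply', integral_norm_sq_fhat,
    integral_profile hκ hZ]
  ring

/-- **Operator-norm bound for frequency-localized `Λ(κ;q)`.** There is an
absolute constant `C` so that for `κ ≥ 1`, `N > 0`, and Schwartz `q` with `q̂`
supported in `{N/2 ≤ |ξ| ≤ 2N}`,
`‖Λ(κ;q)u‖_{L²} ≤ C (√N/(κ+N)) √(log(4+N²/κ²)) ‖q‖_{L²} ‖u‖_{L²}`. -/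
theorem stmt_19 :
    ∃ C : ℝ, 0 < C ∧
      ∀ κ N : ℝ, 1 ≤ κ → 0 < N →
        ∀ q : SchwartzMap ℝ ℂ,
          (∀ ξ : ℝ, fhat (⇑q) ξ ≠ 0 → N / 2 ≤ |ξ| ∧ |ξ| ≤ 2 * N) →
          ∀ u : SchwartzMap ℝ ℂ,
            Real.sqrt (∫ x : ℝ, ‖Lam κ (⇑q) (⇑u) x‖ ^ 2)
              ≤ C * (Real.sqrt N / (κ + N)) * Real.sqrt (Real.log (4 + N ^ 2 / κ ^ 2))
                * Real.sqrt (∫ x : ℝ, ‖q x‖ ^ 2) * Real.sqrt (∫ x : ℝ, ‖u x‖ ^ 2) := by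
  refine ⟨16, by norm_num, fun κ N hκ hN q hq u => ?_⟩
  have hκ0 : 0 < κ := by linarith
  have hQ : 0 ≤ ∫ x, ‖q x‖ ^ 2 := by positivity
  have hU : 0 ≤ ∫ x, ‖u x‖ ^ 2 := by positivity
  have hlog : 1 ≤ log (4 + N ^ 2 / κ ^ 2) := by
    rw [le_log_iff_exp_le (by positivity)]
    have : 0 ≤ N ^ 2 / κ ^ 2 := by positivity
    linarith [exp_one_lt_three]
  have key : ∫ x, ‖Lam κ q u x‖ ^ 2 ≤ 256 * (N / (κ + N) ^ 2) * log (4 + N ^ 2 / κ ^ 2)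
      * (∫ x, ‖q x‖ ^ 2) * ∫ x, ‖u x‖ ^ 2 := by
    rcases le_total N κ with h | h
    · refine (integral_norm_sq_Lam_le_of_fhat_support hκ hN q u fun ξ hξ => (hq ξ hξ).2).trans ?_
      gcongr
      calc 4 * N / κ ^ 2 ≤ 256 * (N / (κ + N) ^ 2) := by
            rw [← mul_div_assoc, div_le_div_iff₀ (by positivity) (by positivity)]
            have : (κ + N) ^ 2 ≤ (2 * κ) ^ 2 := by gcongr; linarith
            nlinarith [mul_le_mul_of_nonneg_left this hN.le, mul_pos hN (pow_pos hκ0 2)]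
        _ ≤ _ := le_mul_of_one_le_right (by positivity) hlog
    · refine (integral_norm_sq_Lam_le_of_le_fhat_support hκ (half_pos hN) q u
        fun ξ hξ => (hq ξ hξ).1).trans ?_
      gcongr ?_ * ?_ * _ * _
      · have : 0 < N / 2 / κ := by positivity
        exact log_nonneg (by linarith)
      · rw [div_div_eq_mul_div, ← mul_div_assoc, div_le_div_iff₀ hN (by positivity)]
        have : (κ + N) ^ 2 ≤ (2 * N) ^ 2 := by gcongr; linarith
        nlinarith
      · have h1 : N / 2 / κ = N / κ / 2 := by ring
        have h2 : N ^ 2 / κ ^ 2 = (N / κ) ^ 2 := by ring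
        rw [h1, h2]
        refine log_le_log (by positivity) ?_
        nlinarith [sq_nonneg (N / κ - 1)]
  have hroot : 16 * (√N / (κ + N)) * √(log (4 + N ^ 2 / κ ^ 2)) * √(∫ x, ‖q x‖ ^ 2)
      * √(∫ x, ‖u x‖ ^ 2) = √(256 * (N / (κ + N) ^ 2) * log (4 + N ^ 2 / κ ^ 2)
      * (∫ x, ‖q x‖ ^ 2) * ∫ x, ‖u x‖ ^ 2) := by
    rw [sqrt_mul (by positivity), sqrt_mul (by positivity), sqrt_mul (by positivity),
      sqrt_mul (by norm_num), sqrt_div hN.le, sqrt_sq (by positivity),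
      show (256 : ℝ) = 16 ^ 2 by norm_num, sqrt_sq (by norm_num)]
  rw [hroot]
  exact sqrt_le_sqrt key
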